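/- Let v = u_FS on the interior P⁰ of the triangle P with vertices (−1,−1), (−1,2), (2,−1), and write (v^{ij}) = (D²v)⁻¹ for the inverse Hessian. Then on P⁰ one has v^{11} < 3, v^{22} < 3 and |v^{12}| < 6, and moreover |∂v^{11}/∂x| ≤ 2, |∂v^{12}/∂x| ≤ 2, |∂v^{12}/∂y| ≤ 2 and |∂v^{22}/∂y| ≤ 2. -/

import Mathlib

open Real Set

noncomputable section

/-- The plane `ℝ²` with the Euclidean metric. -/
abbrev E2 : Type := EuclideanSpace ℝ (Fin 2)

/-- Partial derivative in the `i`-th coordinate direction. -/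
def pder (i : Fin 2) (f : E2 → ℝ) : E2 → ℝ :=
  fun z => fderiv ℝ f z (EuclideanSpace.single i 1)

/-- The Hessian matrix `v_{ij}` of a function on `ℝ²`. -/
def Hess (v : E2 → ℝ) (z : E2) : Matrix (Fin 2) (Fin 2) ℝ :=
  Matrix.of fun i j => pder j (pder i v) z

/-- The inverse Hessian `v^{ij}`. -/
def invHess (v : E2 → ℝ) (z : E2) : Matrix (Fin 2) (Fin 2) ℝ :=
  (Hess v z)⁻¹

/-- `v^{ij}_{kl} = ∂² v^{ij} / ∂z_k ∂z_l`. -/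
def invHessD2 (v : E2 → ℝ) (i j k l : Fin 2) : E2 → ℝ :=
  pder l (pder k fun z => invHess v z i j)

/-- The interior `P⁰` of the triangle with vertices `(-1,-1)`, `(-1,2)`, `(2,-1)`. -/
def Tin : Set E2 := {z | 0 < 1 + z 0 ∧ 0 < 1 + z 1 ∧ 0 < 1 - z 0 - z 1}

/-- The closed triangle with vertices `(-1,-1)`, `(-1,2)`, `(2,-1)`. -/
def Tcl : Set E2 := {z | 0 ≤ 1 + z 0 ∧ 0 ≤ 1 + z 1 ∧ 0 ≤ 1 - z 0 - z 1}

/-- The symplectic potential of the Fubini–Study metric on `ℂP²` in the class `c₁(O(3))`. -/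
def uFS (z : E2) : ℝ :=
  (1 / 2) * ((1 + z 0) * Real.log (1 + z 0) + (1 + z 1) * Real.log (1 + z 1) +
    (1 - z 0 - z 1) * Real.log (1 - z 0 - z 1))

theorem pder_eq_of_hasFDerivAt {f : E2 → ℝ} {L : E2 →L[ℝ] ℝ} {z : E2}
    (h : HasFDerivAt f L z) (i : Fin 2) : pder i f z = L (EuclideanSpace.single i 1) := by
  rw [pder, h.fderiv]

theorem pder_congr_of_eventuallyEq {f g : E2 → ℝ} {z : E2} (h : f =ᶠ[nhds z] g) (i : Fin 2) :
    pder i f z = pder i g z := by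
  rw [pder, pder, h.fderiv_eq]

theorem hasFDerivAt_coord (i : Fin 2) (z : E2) :
    HasFDerivAt (fun w : E2 => w i) (EuclideanSpace.proj i : E2 →L[ℝ] ℝ) z :=
  (EuclideanSpace.proj i : E2 →L[ℝ] ℝ).hasFDerivAt

theorem hasFDerivAt_one_add_coord (i : Fin 2) (z : E2) :
    HasFDerivAt (fun w : E2 => 1 + w i) (EuclideanSpace.proj i : E2 →L[ℝ] ℝ) z :=
  (hasFDerivAt_coord i z).const_add 1

theorem hasFDerivAt_one_sub_coords (z : E2) :
    HasFDerivAt (fun w : E2 => 1 - w 0 - w 1)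
      (-(EuclideanSpace.proj 0 : E2 →L[ℝ] ℝ) - EuclideanSpace.proj 1) z :=
  ((hasFDerivAt_coord 0 z).const_sub 1).sub (hasFDerivAt_coord 1 z)

theorem isOpen_Tin : IsOpen Tin := by
  have h0 : Continuous fun w : E2 => w 0 := by fun_prop
  have h1 : Continuous fun w : E2 => w 1 := by fun_prop
  exact (isOpen_lt continuous_const (continuous_const.add h0)).inter
    ((isOpen_lt continuous_const (continuous_const.add h1)).inter
      (isOpen_lt continuous_const ((continuous_const.sub h0).sub h1)))

theorem pder_uFS {z : E2} (hz : z ∈ Tin) (i : Fin 2) :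
    pder i uFS z = (1 / 2) * (Real.log (1 + z i) - Real.log (1 - z 0 - z 1)) := by
  obtain ⟨ha, hb, hc⟩ := hz
  have h := ((((Real.hasDerivAt_mul_log ha.ne').comp_hasFDerivAt z
    (hasFDerivAt_one_add_coord 0 z)).add ((Real.hasDerivAt_mul_log hb.ne').comp_hasFDerivAt z
    (hasFDerivAt_one_add_coord 1 z))).add ((Real.hasDerivAt_mul_log hc.ne').comp_hasFDerivAt z
    (hasFDerivAt_one_sub_coords z))).const_mul (1 / 2)
  have h' : HasFDerivAt uFS _ z := h
  rw [pder_eq_of_hasFDerivAt h']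
  fin_cases i <;> simp <;> ring

theorem Hess_uFS {z : E2} (hz : z ∈ Tin) :
    Hess uFS z = !![(1 / 2) * ((1 + z 0)⁻¹ + (1 - z 0 - z 1)⁻¹), (1 / 2) * (1 - z 0 - z 1)⁻¹;
      (1 / 2) * (1 - z 0 - z 1)⁻¹, (1 / 2) * ((1 + z 1)⁻¹ + (1 - z 0 - z 1)⁻¹)] := by
  have hev (i : Fin 2) : pder i uFS =ᶠ[nhds z]
      fun w => (1 / 2) * (Real.log (1 + w i) - Real.log (1 - w 0 - w 1)) := by
    filter_upwards [isOpen_Tin.mem_nhds hz] with w hw using pder_uFS hw i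
  obtain ⟨ha, hb, hc⟩ := hz
  have hpos (i : Fin 2) : 1 + z i ≠ 0 := by
    fin_cases i
    exacts [ha.ne', hb.ne']
  have h (i : Fin 2) := (((hasFDerivAt_one_add_coord i z).log (hpos i)).sub
    ((hasFDerivAt_one_sub_coords z).log hc.ne')).const_mul (1 / 2)
  ext i j
  refine (pder_congr_of_eventuallyEq (hev i) j).trans ((pder_eq_of_hasFDerivAt (h i) j).trans ?_)
  fin_cases i <;> fin_cases j <;> simp

theorem invHess_uFS {z : E2} (hz : z ∈ Tin) :
    invHess uFS z = !![2 * ((1 + z 0) - (1 + z 0) * (1 + z 0) / 3),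
      -(2 / 3) * ((1 + z 0) * (1 + z 1));
      -(2 / 3) * ((1 + z 0) * (1 + z 1)), 2 * ((1 + z 1) - (1 + z 1) * (1 + z 1) / 3)] := by
  rw [invHess, Hess_uFS hz]
  obtain ⟨ha, hb, hc⟩ := hz
  refine Matrix.inv_eq_right_inv ?_
  have ha' := ha.ne'
  have hb' := hb.ne'
  have hc' := hc.ne'
  rw [Matrix.mul_fin_two]
  ext i j
  fin_cases i <;> fin_cases j <;> simp <;> field_simp <;> ring

theorem pder_invHess_uFS_diag {z : E2} (hz : z ∈ Tin) (i : Fin 2) :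
    pder i (fun w => invHess uFS w i i) z = 2 - (4 / 3) * (1 + z i) := by
  have hev : (fun w => invHess uFS w i i) =ᶠ[nhds z]
      fun w => 2 * ((1 + w i) - (1 + w i) * (1 + w i) * (1 / 3)) := by
    filter_upwards [isOpen_Tin.mem_nhds hz] with w hw
    rw [invHess_uFS hw]
    fin_cases i <;> simp <;> ring
  have h1 := hasFDerivAt_one_add_coord i z
  have h := (h1.sub ((h1.mul h1).mul_const (1 / 3))).const_mul 2
  refine (pder_congr_of_eventuallyEq hev i).trans ((pder_eq_of_hasFDerivAt h i).trans ?_)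
  simp
  ring

theorem pder_invHess_uFS_offDiag {z : E2} (hz : z ∈ Tin) (i : Fin 2) :
    pder i (fun w => invHess uFS w 0 1) z = -(2 / 3) * (1 + z (1 - i)) := by
  have hev : (fun w => invHess uFS w 0 1) =ᶠ[nhds z]
      fun w => -(2 / 3) * ((1 + w 0) * (1 + w 1)) := by
    filter_upwards [isOpen_Tin.mem_nhds hz] with w hw
    simp [invHess_uFS hw]
  have h := ((hasFDerivAt_one_add_coord 0 z).mul (hasFDerivAt_one_add_coord 1 z)).const_mul
    (-(2 / 3))
  refine (pder_congr_of_eventuallyEq hev i).trans ((pder_eq_of_hasFDerivAt h i).trans ?_)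
  fin_cases i <;> simp

/-- On `P⁰` the inverse Hessian `(v^{ij}) = (D²u_FS)⁻¹` satisfies `v^{11} < 3`, `v^{22} < 3`,
`|v^{12}| < 6`, `|∂v^{11}/∂x| ≤ 2`, `|∂v^{12}/∂x| ≤ 2`, `|∂v^{12}/∂y| ≤ 2`, `|∂v^{22}/∂y| ≤ 2`. -/
theorem uFS_inverse_hessian_bounds :
    ∀ z ∈ Tin,
      invHess uFS z 0 0 < 3 ∧ invHess uFS z 1 1 < 3 ∧ |invHess uFS z 0 1| < 6 ∧
      |pder 0 (fun w => invHess uFS w 0 0) z| ≤ 2 ∧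
      |pder 0 (fun w => invHess uFS w 0 1) z| ≤ 2 ∧
      |pder 1 (fun w => invHess uFS w 0 1) z| ≤ 2 ∧
      |pder 1 (fun w => invHess uFS w 1 1) z| ≤ 2 := by
  intro z hz
  rw [pder_invHess_uFS_diag hz, pder_invHess_uFS_diag hz, pder_invHess_uFS_offDiag hz,
    pder_invHess_uFS_offDiag hz, invHess_uFS hz]
  obtain ⟨ha, hb, hc⟩ := hz
  simp only [Matrix.of_apply, Matrix.cons_val', Matrix.cons_val_zero, Matrix.cons_val_one,
    Matrix.cons_val_fin_one, sub_zero, sub_self, abs_le, abs_lt]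
  refine ⟨?_, ?_, ⟨?_, ?_⟩, ⟨?_, ?_⟩, ⟨?_, ?_⟩, ⟨?_, ?_⟩, ⟨?_, ?_⟩⟩ <;>
    nlinarith [mul_pos ha hb, sq_nonneg (z 0 - 1 / 2), sq_nonneg (z 1 - 1 / 2),
      sq_nonneg (z 0 - z 1), mul_pos ha hc, mul_pos hb hc]
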